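/- arXiv:math/9810053 — 4 statements merged into one kernel-verified Lean document; each statement's English description precedes it below -/
import Mathlib

section
/- Let (T, η, μ) be a monad on a category S that has a terminal object 1. Then the naturality squares of η and of μ at every morphism of S are pullbacks if and only if, for every object Z of S, the naturality squares of η and of μ at the unique morphism Z → 1 are pullbacks. -/
open CategoryTheory CategoryTheory.Limits

/-- If the naturality squares of a transformation at the maps to the terminal object are
pullbacks, then so are all its naturality squares. -/
theorem isPullback_naturality_of_terminal {C D : Type*} [Category* C] [Category* D]
    [HasTerminal C] {F G : C ⥤ D} (α : F ⟶ G)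
    (h : ∀ Z : C, IsPullback (α.app Z) (F.map (terminal.from Z))
      (G.map (terminal.from Z)) (α.app (⊤_ C)))
    {X Y : C} (f : X ⟶ Y) :
    IsPullback (α.app X) (F.map f) (G.map f) (α.app Y) := by
  refine IsPullback.of_bot ?_ (α.naturality f).symm (h Y)
  rw [← F.map_comp, ← G.map_comp, terminal.comp_from]
  exact h X

/-- A monad on a category with a terminal object has all naturality squares of its
unit and multiplication pullbacks iff the naturality squares at the unique maps to
the terminal object are pullbacks. -/
theorem monad_nat_squares_pullback_iff_terminal
    {S : Type u} [Category.{v} S] [HasTerminal S] (T : Monad S) :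
    ((∀ {X Y : S} (f : X ⟶ Y), IsPullback (T.η.app X) f (T.map f) (T.η.app Y)) ∧
     (∀ {X Y : S} (f : X ⟶ Y),
        IsPullback (T.μ.app X) (T.map (T.map f)) (T.map f) (T.μ.app Y))) ↔
    ((∀ Z : S, IsPullback (T.η.app Z) (terminal.from Z)
        (T.map (terminal.from Z)) (T.η.app (⊤_ S))) ∧
     (∀ Z : S, IsPullback (T.μ.app Z) (T.map (T.map (terminal.from Z)))
        (T.map (terminal.from Z)) (T.μ.app (⊤_ S)))) := by
  constructor
  · rintro ⟨hη, hμ⟩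
    exact ⟨fun Z => hη (terminal.from Z), fun Z => hμ (terminal.from Z)⟩
  · rintro ⟨hη, hμ⟩
    exact ⟨fun f => isPullback_naturality_of_terminal T.η hη f,
      fun f => isPullback_naturality_of_terminal T.μ hμ f⟩
end

section
/- For every pair of functions f : X → Z and g : Y → Z between types, the map from List { p : X × Y // f p.1 = g p.2 } to the subtype { q : List X × List Y // q.1.map f = q.2.map g } sending a list L to the pair (L.map (fun p => p.1.1), L.map (fun p => p.1.2)) is a bijection. -/
/-- The list functor sends the fibre product of `f` and `g` to the fibre product
of `List.map f` and `List.map g`, bijectively. -/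
theorem list_fibre_product_bijective {X Y Z : Type u} (f : X → Z) (g : Y → Z) :
    Function.Bijective
      (fun L : List { p : X × Y // f p.1 = g p.2 } =>
        (⟨(L.map (fun p => p.1.1), L.map (fun p => p.1.2)), by
            simp only [List.map_map]
            exact List.map_congr_left (fun p _ => p.2)⟩ :
          { q : List X × List Y // q.1.map f = q.2.map g })) := by
  constructor
  · intro L M h
    have h' := congrArg Subtype.val h
    obtain ⟨h₁, h₂⟩ := Prod.mk.inj h'
    clear h h'
    induction L generalizing M with
    | nil => exact (List.map_eq_nil_iff.mp h₁.symm).symm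
    | cons a L ih =>
      cases M with
      | nil => exact absurd h₁ (List.cons_ne_nil _ _)
      | cons b M =>
        obtain ⟨ha₁, hL₁⟩ := List.cons.inj h₁
        obtain ⟨ha₂, hL₂⟩ := List.cons.inj h₂
        exact congrArg₂ List.cons (Subtype.ext (Prod.ext ha₁ ha₂)) (ih hL₁ hL₂)
  · rintro ⟨⟨l, m⟩, h⟩
    suffices H : ∃ L : List { p : X × Y // f p.1 = g p.2 },
        L.map (fun p => p.1.1) = l ∧ L.map (fun p => p.1.2) = m by
      obtain ⟨L, h₁, h₂⟩ := H
      exact ⟨L, Subtype.ext (Prod.ext h₁ h₂)⟩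
    change l.map f = m.map g at h
    induction l generalizing m with
    | nil => exact ⟨[], rfl, (List.map_eq_nil_iff.mp h.symm).symm⟩
    | cons x l ih =>
      cases m with
      | nil => exact absurd h (List.cons_ne_nil _ _)
      | cons y m =>
        obtain ⟨hxy, hlm⟩ := List.cons.inj h
        obtain ⟨L, h₁, h₂⟩ := ih m hlm
        exact ⟨⟨(x, y), hxy⟩ :: L, congrArg (x :: ·) h₁, congrArg (y :: ·) h₂⟩
end

section
/- Let C be a small category and h : C ⥤ Type a functor. Then the functor category from the category of elements of h to Type is equivalent to the slice of the functor category over h: (Elements h ⥤ Type) ≌ Over h, where Over h is taken in the functor category C ⥤ Type. -/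
open CategoryTheory

namespace CategoryTheory.Functor.Elements

universe w v' u'

variable {C : Type u'} [Category.{v'} C] {h : C ⥤ Type w}

/-- The functor on the category of elements of `h` sending `(c, x)` to the fibre over `x` of
the component at `c` of an object of `Over h`. -/
def fiber (X : Over h) : h.Elements ⥤ Type w where
  obj p := {y : X.left.obj p.1 // X.hom.app p.1 y = p.2}
  map {p q} f := ↾fun y => ⟨X.left.map f.val y.1, by
    have hn := NatTrans.naturality_apply X.hom f.val y.1
    have hy := y.2
    have hf := f.2
    exact hn.trans ((congrArg (h.map f.val) hy).trans hf)⟩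
  map_id p := by
    refine ConcreteCategory.hom_ext _ _ fun y => ?_
    exact Subtype.ext (Functor.map_id_apply X.left p.1 y.1)
  map_comp f g := by
    refine ConcreteCategory.hom_ext _ _ fun y => ?_
    exact Subtype.ext (Functor.map_comp_apply X.left f.val g.val y.1)

variable (h) in
/-- Taking fibres, as a functor from `Over h`. -/
def fiberFunctor : Over h ⥤ (h.Elements ⥤ Type w) where
  obj X := fiber X
  map {X Y} φ :=
    { app p := ↾fun y => ⟨φ.left.app p.1 y.1, by
        have hw := ConcreteCategory.congr_hom (NatTrans.congr_app (Over.w φ) p.1) y.1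
        exact hw.trans y.2⟩
      naturality p q f := by
        refine ConcreteCategory.hom_ext _ _ ?_
        rintro ⟨y, hy⟩
        have hn : φ.left.app q.1 (X.left.map f.val y) = Y.left.map f.val (φ.left.app p.1 y) :=
          NatTrans.naturality_apply φ.left f.val y
        exact Subtype.ext hn }
  map_id X := by
    ext p y
    rfl
  map_comp φ ψ := by
    ext p y
    rfl

lemma fiber_app_val_eq {X Y : Over h} (α : fiber X ⟶ fiber Y) {c : C} (y : X.left.obj c)
    {x : h.obj c} (hx : X.hom.app c y = x) :
    (α.app ⟨c, x⟩ ⟨y, hx⟩).1 = (α.app ⟨c, X.hom.app c y⟩ ⟨y, rfl⟩).1 := by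
  subst hx
  rfl

/-- The morphism over `h` assembled from a natural family of maps between fibres. -/
def overHomOfFiberHom {X Y : Over h} (α : fiber X ⟶ fiber Y) : X ⟶ Y :=
  Over.homMk
    { app c := ↾fun y => (α.app ⟨c, X.hom.app c y⟩ ⟨y, rfl⟩).1
      naturality c d f := by
        ext y
        let g : h.elementsMk c (X.hom.app c y) ⟶ h.elementsMk d (h.map f (X.hom.app c y)) := ⟨f, rfl⟩
        have hn := congrArg Subtype.val (NatTrans.naturality_apply α g ⟨y, rfl⟩)
        have hx : X.hom.app d (X.left.map f y) = h.map f (X.hom.app c y) :=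
          NatTrans.naturality_apply X.hom f y
        exact (fiber_app_val_eq α (X.left.map f y) hx).symm.trans hn }
    (by
      ext c y
      exact (α.app ⟨c, X.hom.app c y⟩ ⟨y, rfl⟩).2)

instance : (fiberFunctor h).Faithful where
  map_injective {X Y} φ ψ hφ := by
    ext c y
    have hp := ConcreteCategory.congr_hom
      (NatTrans.congr_app hφ (⟨c, X.hom.app c y⟩ : h.Elements)) ⟨y, rfl⟩
    exact congrArg Subtype.val hp

instance : (fiberFunctor h).Full where
  map_surjective {X Y} α := ⟨overHomOfFiberHom α, by
    ext p : 2
    refine ConcreteCategory.hom_ext _ _ fun y => ?_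
    exact Subtype.ext (fiber_app_val_eq α y.1 y.2).symm⟩

lemma sigma_mk_map_eq (F : h.Elements ⥤ Type w) {c d : C} {f f' : c ⟶ d} (hf : f = f')
    {x : h.obj c} {y y' : h.obj d} (hy : h.map f x = y) (hy' : h.map f' x = y')
    (a : F.obj ⟨c, x⟩) :
    (⟨y, F.map (Y := ⟨d, y⟩) ⟨f, hy⟩ a⟩ : Σ z : h.obj d, F.obj ⟨d, z⟩) =
      ⟨y', F.map (Y := ⟨d, y'⟩) ⟨f', hy'⟩ a⟩ := by
  subst hf hy hy'
  rfl

/-- The functor sending `c` to the disjoint union over `x : h.obj c` of the values of `F`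
at `(c, x)`. -/
def total (F : h.Elements ⥤ Type w) : C ⥤ Type w where
  obj c := Σ x : h.obj c, F.obj ⟨c, x⟩
  map {c d} f := ↾fun s => ⟨h.map f s.1, F.map (Y := ⟨d, h.map f s.1⟩) ⟨f, rfl⟩ s.2⟩
  map_id c := by
    refine ConcreteCategory.hom_ext _ _ fun ⟨x, a⟩ => ?_
    refine (sigma_mk_map_eq F rfl rfl (Functor.map_id_apply h c x) a).trans ?_
    exact congrArg (Sigma.mk x) (Functor.map_id_apply F ⟨c, x⟩ a)
  map_comp {c d e} f g := by
    refine ConcreteCategory.hom_ext _ _ fun ⟨x, a⟩ => ?_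
    refine (sigma_mk_map_eq F rfl rfl (Functor.map_comp_apply h f g x) a).trans ?_
    let f' : h.elementsMk c x ⟶ h.elementsMk d (h.map f x) := ⟨f, rfl⟩
    let g' : h.elementsMk d (h.map f x) ⟶
        h.elementsMk e (h.map g (h.map f x)) := ⟨g, rfl⟩
    exact congrArg (Sigma.mk (h.map g (h.map f x))) (Functor.map_comp_apply F f' g' a)

lemma exists_sigma_mk_eq (F : h.Elements ⥤ Type w) {c : C} {x : h.obj c}
    (s : Σ z : h.obj c, F.obj ⟨c, z⟩) (hs : s.1 = x) :
    ∃ a : F.obj ⟨c, x⟩, (⟨x, a⟩ : Σ z : h.obj c, F.obj ⟨c, z⟩) = s := by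
  subst hs
  exact ⟨s.2, rfl⟩

/-- The total functor of `F` together with its projection to `h`. -/
def totalOver (F : h.Elements ⥤ Type w) : Over h :=
  Over.mk (Y := total F)
    { app c := ↾fun s => s.1
      naturality c d f := by
        ext s
        rfl }

/-- The inclusion of the values of `F` as the fibres of its total functor. -/
def toFiberTotal (F : h.Elements ⥤ Type w) : F ⟶ fiber (totalOver F) where
  app p := ↾fun a => ⟨⟨p.2, a⟩, rfl⟩
  naturality p q f := by
    refine ConcreteCategory.hom_ext _ _ fun a => ?_
    exact Subtype.ext (sigma_mk_map_eq F rfl f.2 rfl a)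

instance (F : h.Elements ⥤ Type w) : IsIso (toFiberTotal F) := by
  have (p : h.Elements) : IsIso ((toFiberTotal F).app p) := by
    rw [isIso_iff_bijective]
    constructor
    · intro a b hab
      exact eq_of_heq (Sigma.mk.inj (congrArg Subtype.val hab)).2
    · rintro ⟨s, hs⟩
      obtain ⟨a, ha⟩ := exists_sigma_mk_eq F s hs
      exact ⟨a, Subtype.ext ha⟩
  exact NatIso.isIso_of_isIso_app _

instance : (fiberFunctor h).EssSurj where
  mem_essImage F := ⟨totalOver F, ⟨(asIso (toFiberTotal F)).symm⟩⟩

instance : (fiberFunctor h).IsEquivalence where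

end CategoryTheory.Functor.Elements

/-- For `h : C ⥤ Type`, the functor category from the category of elements of `h`
to `Type` is equivalent to the slice of the functor category `C ⥤ Type` over `h`
(the Grothendieck construction / slicing). -/
theorem elements_functor_category_equiv_over (C : Type u) [SmallCategory C]
    (h : C ⥤ Type u) :
    Nonempty ((h.Elements ⥤ Type u) ≌ Over h) := by
  exact ⟨(Functor.Elements.fiberFunctor h).asEquivalence.symm⟩
end

section
/- Let T be a monad on a category C and let (A, h : T A ⟶ A) be a T-algebra. Then there exists a monad S on the over category Over A such that the Eilenberg–Moore category of S-algebras is equivalent to the over category of the object (A, h) in the Eilenberg–Moore category of T-algebras: Algebras(S) ≌ Over (A, h) in Algebras(T). -/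
open CategoryTheory

namespace CategoryTheory.Monad

universe v u

variable {C : Type u} [Category.{v} C] {T : Monad C} (A : T.Algebra)

/-- The slice of a monad `T` at a `T`-algebra `(A, h)`: the monad on `Over A` sending
`f : X ⟶ A` to `T f ≫ h : T X ⟶ A`. -/
@[simps]
def slice : Monad (Over A.A) where
  toFunctor :=
    { obj X := Over.mk (T.map X.hom ≫ A.a)
      map f := Over.homMk (T.map f.left) (by
        dsimp
        rw [← Functor.map_comp_assoc, Over.w])
      map_id X := by ext; exact T.map_id X.left
      map_comp f g := by ext; exact T.map_comp f.left g.left }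
  η :=
    { app X := Over.homMk (T.η.app X.left) (by
        have h := T.η.naturality_assoc X.hom A.a
        dsimp at h ⊢
        rw [← h, A.unit, Category.comp_id])
      naturality X Y f := by ext; exact T.η.naturality f.left }
  μ :=
    { app X := Over.homMk (T.μ.app X.left) (by
        have h := T.μ.naturality_assoc X.hom A.a
        dsimp at h ⊢
        rw [← h, A.assoc, Functor.map_comp, Category.assoc])
      naturality X Y f := by ext; exact T.μ.naturality f.left }
  assoc X := by ext; exact T.assoc X.left
  left_unit X := by ext; exact T.left_unit X.left
  right_unit X := by ext; exact T.right_unit X.left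

/-- The `T`-algebra underlying an algebra for the slice monad. -/
@[simps]
def sliceAlgebraToAlgebra (B : (slice A).Algebra) : T.Algebra where
  A := B.A.left
  a := B.a.left
  unit := congrArg CommaMorphism.left B.unit
  assoc := congrArg CommaMorphism.left B.assoc

/-- The functor from algebras for the slice monad to the over category of `A`. -/
@[simps]
def sliceAlgebraToOver : (slice A).Algebra ⥤ Over A where
  obj B := Over.mk (Y := sliceAlgebraToAlgebra A B) { f := B.A.hom, h := (Over.w B.a).symm }
  map f := Over.homMk { f := f.f.left, h := congrArg CommaMorphism.left f.h } (by
    ext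
    exact Over.w f.f)

/-- The functor from the over category of `A` to algebras for the slice monad. -/
@[simps]
def overToSliceAlgebra : Over A ⥤ (slice A).Algebra where
  obj X :=
    { A := Over.mk X.hom.f
      a := Over.homMk X.left.a X.hom.h.symm
      unit := by ext; exact X.left.unit
      assoc := by ext; exact X.left.assoc }
  map f :=
    { f := Over.homMk f.left.f (congrArg Algebra.Hom.f (Over.w f))
      h := by ext; exact f.left.h }

/-- Algebras for the slice monad at `A` are equivalent to algebras over `A`. -/
def sliceAlgebraEquivalence : (slice A).Algebra ≌ Over A where
  functor := sliceAlgebraToOver A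
  inverse := overToSliceAlgebra A
  unitIso := NatIso.ofComponents (fun B => Algebra.isoMk (Over.isoMk (Iso.refl B.A.left)
      (Category.id_comp _)) (by
    ext
    exact (congrArg (· ≫ B.a.left) (T.map_id _)).trans
      ((Category.id_comp _).trans (Category.comp_id _).symm))) (fun f => by
    ext
    exact (Category.comp_id _).trans (Category.id_comp _).symm)
  counitIso := NatIso.ofComponents (fun X => Over.isoMk (Algebra.isoMk (Iso.refl X.left.A) (by
      exact (congrArg (· ≫ X.left.a) (T.map_id _)).trans
        ((Category.id_comp _).trans (Category.comp_id _).symm))) (by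
    ext
    exact Category.id_comp _)) (fun f => by
    ext
    exact (Category.comp_id _).trans (Category.id_comp _).symm)
  functor_unitIso_comp B := by
    ext
    exact Category.id_comp _

end CategoryTheory.Monad

/-- Slicing of monads: for a monad `T` on `C` and a `T`-algebra `(A, h)`, there is
a monad `S` on `Over A` whose Eilenberg–Moore category is equivalent to the over
category of `(A, h)` in the Eilenberg–Moore category of `T`. -/
theorem slice_monad_exists {C : Type u} [Category.{v} C] (T : Monad C)
    (A : T.Algebra) :
    ∃ S : Monad (Over A.A), Nonempty (S.Algebra ≌ Over A) :=
  ⟨Monad.slice A, ⟨Monad.sliceAlgebraEquivalence A⟩⟩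
end
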